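/- arXiv:1207.5011 — 4 statements merged into one kernel-verified Lean document; each statement's English description precedes it below -/
import Mathlib

section
/- Let λ be a real number with 0 < λ < 1 and let n ≥ 1 be an integer. For c ∈ (0, 1/λ) define β(λ,c) = ((λ⁻¹ − 1)/n)·(1 − (n+1)/(∑_{i=0}^{n} (1 − cλ)^{−i})). Then for every c ∈ (0, 1/λ) one has 0 < β(λ,c) < (λ⁻¹ − 1)/n, and sup{ β(λ,c) : c ∈ (0, 1/λ) } = (λ⁻¹ − 1)/n. -/
/-- The threshold angle `β(λ,c) = ((λ⁻¹−1)/n)·(1 − (n+1)/(∑_{i=0}^n (1−cλ)^{−i}))`. -/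
noncomputable def betaFun (lam : ℝ) (n : ℕ) (c : ℝ) : ℝ :=
  ((lam⁻¹ - 1) / n) * (1 - (n + 1 : ℝ) / (∑ i ∈ Finset.range (n + 1), (1 - c * lam) ^ (-(i : ℤ))))

/-- Since every term is at least `1`, the sum exceeds the number of its terms. -/
theorem add_one_lt_sum_zpow_neg {x : ℝ} (hx0 : 0 < x) (hx1 : x < 1) {n : ℕ} (hn : 1 ≤ n) :
    (n + 1 : ℝ) < ∑ i ∈ Finset.range (n + 1), x ^ (-(i : ℤ)) := by
  have hx : 1 < x⁻¹ := (one_lt_inv₀ hx0).2 hx1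
  calc (n + 1 : ℝ) = ∑ _i ∈ Finset.range (n + 1), (1 : ℝ) := by simp
    _ < ∑ i ∈ Finset.range (n + 1), x ^ (-(i : ℤ)) := by
      refine Finset.sum_lt_sum (fun i _ => ?_) ⟨1, by simp; omega, by simpa using hx⟩
      rw [zpow_neg, zpow_natCast, ← inv_pow]
      exact one_le_pow₀ hx.le

theorem inv_le_sum_zpow_neg {x : ℝ} (hx : 0 < x) {n : ℕ} (hn : 1 ≤ n) :
    x⁻¹ ≤ ∑ i ∈ Finset.range (n + 1), x ^ (-(i : ℤ)) := by
  have h := Finset.single_le_sum (f := fun i : ℕ => x ^ (-(i : ℤ))) (s := Finset.range (n + 1))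
    (fun i _ => (zpow_pos hx _).le) (Finset.mem_range.2 (show 1 < n + 1 by omega))
  simpa using h

/-- For `0 < λ < 1` and `n ≥ 1`, one has `0 < β(λ,c) < (λ⁻¹−1)/n` for all `c ∈ (0,1/λ)`,
and `sup { β(λ,c) : c ∈ (0,1/λ) } = (λ⁻¹−1)/n`. -/
theorem betaFun_bounds_and_sup (lam : ℝ) (hlam0 : 0 < lam) (hlam1 : lam < 1)
    (n : ℕ) (hn : 1 ≤ n) :
    (∀ c ∈ Set.Ioo (0 : ℝ) (1 / lam),
        0 < betaFun lam n c ∧ betaFun lam n c < (lam⁻¹ - 1) / n) ∧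
      sSup (betaFun lam n '' Set.Ioo (0 : ℝ) (1 / lam)) = (lam⁻¹ - 1) / n := by
  have hK : 0 < (lam⁻¹ - 1) / n :=
    div_pos (sub_pos.2 ((one_lt_inv₀ hlam0).2 hlam1)) (by exact_mod_cast hn)
  have bounds : ∀ c ∈ Set.Ioo (0 : ℝ) (1 / lam),
      0 < betaFun lam n c ∧ betaFun lam n c < (lam⁻¹ - 1) / n := by
    rintro c ⟨hc0, hc1⟩
    have hcl : c * lam < 1 := (lt_div_iff₀ hlam0).1 hc1
    have hS := add_one_lt_sum_zpow_neg (x := 1 - c * lam) (by linarith)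
      (by linarith [mul_pos hc0 hlam0]) hn
    have hn1 : (0 : ℝ) < n + 1 := by positivity
    unfold betaFun
    refine ⟨mul_pos hK (sub_pos.2 ((div_lt_one (hn1.trans hS)).2 hS)),
      mul_lt_of_lt_one_right hK (sub_lt_self _ (div_pos hn1 (hn1.trans hS)))⟩
  refine ⟨bounds, csSup_eq_of_forall_le_of_forall_lt_exists_gt ?_ ?_ ?_⟩
  · exact (Set.nonempty_Ioo.2 (by positivity)).image _
  · rintro _ ⟨c, hc, rfl⟩
    exact (bounds c hc).2.le
  · intro w hw
    set K := (lam⁻¹ - 1) / n with hKdef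
    have hn1 : (0 : ℝ) < n + 1 := by positivity
    obtain ⟨x, hx0, hx⟩ := exists_between
      (lt_min one_pos (div_pos (sub_pos.2 hw) (mul_pos hK hn1)))
    obtain ⟨hx1, hxw⟩ := lt_min_iff.1 hx
    rw [lt_div_iff₀ (mul_pos hK hn1)] at hxw
    refine ⟨_, ⟨(1 - x) / lam, ⟨div_pos (by linarith) hlam0, ?_⟩, rfl⟩, ?_⟩
    · exact div_lt_div_of_pos_right (by linarith) hlam0
    · have hc : 1 - (1 - x) / lam * lam = x := by field_simp; ring
      have hS : (n + 1 : ℝ) / (∑ i ∈ Finset.range (n + 1), x ^ (-(i : ℤ))) ≤ (n + 1) * x := by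
        rw [div_eq_mul_inv]
        exact mul_le_mul_of_nonneg_left
          (inv_le_of_inv_le₀ hx0 (inv_le_sum_zpow_neg hx0 hn)) hn1.le
      rw [betaFun, hc, ← hKdef]
      linarith [mul_le_mul_of_nonneg_left hS hK.le]
end

section
/- Let λ be a real number with 0 < λ < 1, let n ≥ 1 be an integer, and let β be a real number with 0 ≤ β < (λ⁻¹ − 1)/n. Then there exists c ∈ (0, 1/λ) such that β < β(λ,c), where β(λ,c) = ((λ⁻¹ − 1)/n)·(1 − (n+1)/(∑_{i=0}^{n} (1 − cλ)^{−i})). -/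
open Filter Topology in
/-- `β(λ,c)` tends to `(λ⁻¹−1)/n` as `c` increases to `1/λ`. -/
theorem tendsto_betaFun_nhdsLT {lam : ℝ} (hlam : 0 < lam) {n : ℕ} (hn : 1 ≤ n) :
    Tendsto (betaFun lam n) (𝓝[<] (1 / lam)) (𝓝 ((lam⁻¹ - 1) / n)) := by
  have hpos : ∀ᶠ c in 𝓝[<] (1 / lam), 0 < 1 - c * lam := by
    filter_upwards [self_mem_nhdsWithin] with c hc
    exact sub_pos.2 ((lt_div_iff₀ hlam).1 hc)
  have hzero : Tendsto (fun c => 1 - c * lam) (𝓝[<] (1 / lam)) (𝓝[>] 0) := by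
    refine tendsto_nhdsWithin_iff.2 ⟨?_, hpos⟩
    have hcont : Continuous fun c : ℝ => 1 - c * lam := by fun_prop
    simpa [hlam.ne'] using (hcont.tendsto (1 / lam)).mono_left nhdsWithin_le_nhds
  have hsum : Tendsto (fun c => ∑ i ∈ Finset.range (n + 1), (1 - c * lam) ^ (-(i : ℤ)))
      (𝓝[<] (1 / lam)) atTop := by
    refine tendsto_atTop_mono' _ ?_ (tendsto_inv_nhdsGT_zero.comp hzero)
    filter_upwards [hpos] with c hc
    simpa using Finset.single_le_sum
      (f := fun i : ℕ => (1 - c * lam) ^ (-(i : ℤ))) (fun i _ => (zpow_pos hc _).le)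
      (Finset.mem_range.2 (by omega : 1 < n + 1))
  have h := ((hsum.const_div_atTop (n + 1 : ℝ)).const_sub 1).const_mul ((lam⁻¹ - 1) / n)
  rw [sub_zero, mul_one] at h
  exact h

/-- For `0 < λ < 1`, `n ≥ 1`, and `0 ≤ β < (λ⁻¹−1)/n`, there is `c ∈ (0,1/λ)`
with `β < β(λ,c)`: the pair is destabilized by some `cD`. -/
theorem exists_destabilizing_c (lam : ℝ) (hlam0 : 0 < lam) (hlam1 : lam < 1)
    (n : ℕ) (hn : 1 ≤ n) (β : ℝ) (hβ0 : 0 ≤ β) (hβ : β < (lam⁻¹ - 1) / n) :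
    ∃ c ∈ Set.Ioo (0 : ℝ) (1 / lam), β < betaFun lam n c := by
  have hIoo := Ioo_mem_nhdsLT (one_div_pos.2 hlam0)
  have hlt := (tendsto_betaFun_nhdsLT hlam0 hn).eventually_const_lt hβ
  exact (Filter.Eventually.and hIoo hlt).exists
end

section
/- Let β ∈ ℝ. Define the real polynomials a₀(x) = 4 − x − x²/2, a₁(x) = 4 − x/2, ã₀(x) = (1−β)(8−x), and set a₀ = a₀(0) = 4, a₁ = a₁(0) = 4, ã₀ = ã₀(0) = 8(1−β). Then 2a₀·∫₀² ( a₁(x) − ½ã₀(x) + ½a₀'(x) ) dx − 2·(a₁ − ã₀/2)·∫₀² a₀(x) dx = 8·(7β/3 − 2). In particular this quantity is negative if and only if β < 6/7. -/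
/-- Log-Futaki invariant computation on `Bl_p ℙ²` for the deformation to the normal cone
of the exceptional divisor with `c = 2`: with `a₀(x) = 4 − x − x²/2`, `a₁(x) = 4 − x/2`,
`ã₀(x) = (1−β)(8−x)`, `a₀ = a₁ = 4`, `ã₀ = 8(1−β)`, one has
`2a₀·∫₀²(a₁(x) − ½ã₀(x) + ½a₀'(x))dx − 2(a₁ − ã₀/2)·∫₀² a₀(x)dx = 8(7β/3 − 2)`,
which is negative iff `β < 6/7`. -/
theorem logFutaki_blowup_P2 (β : ℝ) :
    (2 * (4 : ℝ) * (∫ x in (0 : ℝ)..2,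
          ((4 - x / 2) - (1 - β) * (8 - x) / 2 + (deriv (fun y : ℝ => 4 - y - y ^ 2 / 2) x) / 2))
        - 2 * ((4 : ℝ) - 8 * (1 - β) / 2) * (∫ x in (0 : ℝ)..2, (4 - x - x ^ 2 / 2))
      = 8 * (7 * β / 3 - 2)) ∧
      (8 * (7 * β / 3 - 2) < 0 ↔ β < 6 / 7) := by
  have hderiv (x : ℝ) : deriv (fun y : ℝ => 4 - y - y ^ 2 / 2) x = -1 - x := by
    have h := ((hasDerivAt_id x).const_sub 4).sub (((hasDerivAt_id x).pow 2).div_const 2)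
    refine (h.congr_deriv ?_).deriv
    simp
  have hquad (a b c : ℝ) :
      ∫ x in (0 : ℝ)..2, (a + b * x + c * x ^ 2) = 2 * a + 2 * b + 8 / 3 * c := by
    rw [intervalIntegral.integral_add (Continuous.intervalIntegrable (by fun_prop) _ _)
        (Continuous.intervalIntegrable (by fun_prop) _ _),
      intervalIntegral.integral_add (Continuous.intervalIntegrable (by fun_prop) _ _)
        (Continuous.intervalIntegrable (by fun_prop) _ _),
      intervalIntegral.integral_const_mul, intervalIntegral.integral_const_mul,
      intervalIntegral.integral_const, integral_id, integral_pow]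
    norm_num
    ring
  have hlin : ∫ x in (0 : ℝ)..2,
      ((4 - x / 2) - (1 - β) * (8 - x) / 2 +
        (deriv (fun y : ℝ => 4 - y - y ^ 2 / 2) x) / 2) = 7 * β - 2 := by
    have h := hquad (4 * β - 1 / 2) (-(β + 1) / 2) 0
    calc
      _ = ∫ x in (0 : ℝ)..2, (4 * β - 1 / 2 + -(β + 1) / 2 * x + 0 * x ^ 2) := by
        congr 1
        funext x
        rw [hderiv]
        ring
      _ = 7 * β - 2 := by
        rw [h]
        ring
  have hvol : ∫ x in (0 : ℝ)..2, (4 - x - x ^ 2 / 2) = 14 / 3 := by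
    have h := hquad 4 (-1) (-1 / 2)
    calc
      _ = ∫ x in (0 : ℝ)..2, (4 + -1 * x + -1 / 2 * x ^ 2) := by
        congr 1
        funext x
        ring
      _ = 14 / 3 := by
        rw [h]
        norm_num
  refine ⟨?_, ?_⟩
  · rw [hlin, hvol]
    ring
  · constructor <;> intro h <;> linarith
end

section
/- For u, v ∈ ℂ² define P(u,v) = (u₀v₀ + u₁v₁, i(u₀v₁ + u₁v₀), i(u₀v₀ − u₁v₁)) ∈ ℂ³. Let u, v, u', v' ∈ ℂ² all be nonzero. Then there exists a nonzero t ∈ ℂ with P(u',v') = t·P(u,v) if and only if either (u' is a nonzero scalar multiple of u and v' is a nonzero scalar multiple of v) or (u' is a nonzero scalar multiple of v and v' is a nonzero scalar multiple of u). -/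
/-- The map `P(u,v) = (u₀v₀+u₁v₁, i(u₀v₁+u₁v₀), i(u₀v₀−u₁v₁))` underlying the double
cover `ℙ¹×ℙ¹ → ℙ²`. -/
noncomputable def Pmap (u v : ℂ × ℂ) : ℂ × ℂ × ℂ :=
  (u.1 * v.1 + u.2 * v.2, Complex.I * (u.1 * v.2 + u.2 * v.1),
    Complex.I * (u.1 * v.1 - u.2 * v.2))

theorem Pmap_comm (u v : ℂ × ℂ) : Pmap u v = Pmap v u := by
  simp only [Pmap, Prod.mk.injEq]
  refine ⟨?_, ?_, ?_⟩ <;> ring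

theorem Pmap_smul_smul (a b : ℂ) (u v : ℂ × ℂ) :
    Pmap (a • u) (b • v) = (a * b) • Pmap u v := by
  simp only [Pmap, Prod.smul_fst, Prod.smul_snd, Prod.smul_mk, smul_eq_mul, Prod.mk.injEq]
  refine ⟨?_, ?_, ?_⟩ <;> ring

/-- Proportionality of values of `P` in terms of the coefficients of the binary quadratic form
with roots `u` and `v`. -/
theorem Pmap_eq_smul_iff (u v u' v' : ℂ × ℂ) (t : ℂ) :
    Pmap u' v' = t • Pmap u v ↔
      u'.1 * v'.1 = t * (u.1 * v.1) ∧ u'.2 * v'.2 = t * (u.2 * v.2) ∧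
        u'.1 * v'.2 + u'.2 * v'.1 = t * (u.1 * v.2 + u.2 * v.1) := by
  simp only [Pmap, Prod.smul_mk, smul_eq_mul, Prod.mk.injEq, mul_left_comm t Complex.I,
    mul_right_inj' Complex.I_ne_zero]
  constructor
  · rintro ⟨h₁, h₂, h₃⟩
    exact ⟨by linear_combination (h₁ + h₃) / 2, by linear_combination (h₁ - h₃) / 2, h₂⟩
  · rintro ⟨h₁, h₂, h₃⟩
    exact ⟨by linear_combination h₁ + h₂, h₃, by linear_combination h₁ - h₂⟩

theorem exists_ne_zero_smul_of_det_eq_zero {K : Type*} [Field K] {u w : K × K}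
    (hu : u ≠ 0) (hw : w ≠ 0) (h : u.1 * w.2 - u.2 * w.1 = 0) :
    ∃ s : K, s ≠ 0 ∧ w = s • u := by
  obtain ⟨s, hs⟩ : ∃ s : K, w = s • u := by
    by_cases h₁ : u.1 = 0
    · have h₂ : u.2 ≠ 0 := fun h₂ => hu (Prod.ext h₁ h₂)
      refine ⟨w.2 / u.2, Prod.ext ?_ ?_⟩ <;> simp only [Prod.smul_fst, Prod.smul_snd, smul_eq_mul]
      · field_simp
        linear_combination -h
      · field_simp
    · refine ⟨w.1 / u.1, Prod.ext ?_ ?_⟩ <;>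
        simp only [Prod.smul_fst, Prod.smul_snd, smul_eq_mul]
      · field_simp
      · field_simp
        linear_combination h
  refine ⟨s, ?_, hs⟩
  rintro rfl
  exact hw (by simpa using hs)

theorem eq_smul_of_Pmap_eq_smul {u v w : ℂ × ℂ} {t : ℂ} (hu : u ≠ 0)
    (h : Pmap u w = t • Pmap u v) : w = t • v := by
  obtain ⟨h₁, h₂, h₃⟩ := (Pmap_eq_smul_iff u v u w t).1 h
  by_cases hu₁ : u.1 = 0
  · have hu₂ : u.2 ≠ 0 := fun hu₂ => hu (Prod.ext hu₁ hu₂)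
    refine Prod.ext (mul_left_cancel₀ hu₂ ?_) (mul_left_cancel₀ hu₂ ?_) <;>
      simp only [Prod.smul_fst, Prod.smul_snd, smul_eq_mul]
    · linear_combination h₃ - (w.2 - t * v.2) * hu₁
    · linear_combination h₂
  · have hw₁ : w.1 = t * v.1 := mul_left_cancel₀ hu₁ (by linear_combination h₁)
    refine Prod.ext hw₁ (mul_left_cancel₀ hu₁ ?_)
    simp only [Prod.smul_snd, smul_eq_mul]
    linear_combination h₃ - u.2 * hw₁

theorem exists_smul_of_Pmap_smul_eq_smul {u v v' : ℂ × ℂ} {s t : ℂ} (hu : u ≠ 0)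
    (hs : s ≠ 0) (ht : t ≠ 0) (h : Pmap (s • u) v' = t • Pmap u v) :
    ∃ r : ℂ, r ≠ 0 ∧ v' = r • v := by
  refine ⟨s⁻¹ * t, mul_ne_zero (inv_ne_zero hs) ht, eq_smul_of_Pmap_eq_smul hu ?_⟩
  have h' : s • Pmap u v' = t • Pmap u v := by
    rw [← h]
    simpa using (Pmap_smul_smul s 1 u v').symm
  rw [mul_smul, ← h', inv_smul_smul₀ hs]

/-- The fibers of `P` on nonzero vectors are exactly the swap orbits:
`P(u',v')` is a nonzero multiple of `P(u,v)` iff (`u' ∥ u` and `v' ∥ v`) or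
(`u' ∥ v` and `v' ∥ u`). -/
theorem Pmap_fibers (u v u' v' : ℂ × ℂ) (hu : u ≠ 0) (hv : v ≠ 0)
    (hu' : u' ≠ 0) (hv' : v' ≠ 0) :
    (∃ t : ℂ, t ≠ 0 ∧ Pmap u' v' = t • Pmap u v) ↔
      ((∃ s : ℂ, s ≠ 0 ∧ u' = s • u) ∧ (∃ s : ℂ, s ≠ 0 ∧ v' = s • v)) ∨
        ((∃ s : ℂ, s ≠ 0 ∧ u' = s • v) ∧ (∃ s : ℂ, s ≠ 0 ∧ v' = s • u)) := by
  constructor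
  · rintro ⟨t, ht, h⟩
    obtain ⟨h₁, h₂, h₃⟩ := (Pmap_eq_smul_iff u v u' v' t).1 h
    have hdet : (u.1 * u'.2 - u.2 * u'.1) * (v.1 * u'.2 - v.2 * u'.1) = 0 :=
      mul_left_cancel₀ ht (by
        linear_combination -u'.2 ^ 2 * h₁ - u'.1 ^ 2 * h₂ + u'.1 * u'.2 * h₃)
    rcases mul_eq_zero.1 hdet with hd | hd
    · obtain ⟨s, hs, rfl⟩ := exists_ne_zero_smul_of_det_eq_zero hu hu' hd
      exact Or.inl ⟨⟨s, hs, rfl⟩, exists_smul_of_Pmap_smul_eq_smul hu hs ht h⟩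
    · obtain ⟨s, hs, rfl⟩ := exists_ne_zero_smul_of_det_eq_zero hv hu' hd
      rw [Pmap_comm u v] at h
      exact Or.inr ⟨⟨s, hs, rfl⟩, exists_smul_of_Pmap_smul_eq_smul hv hs ht h⟩
  · rintro (⟨⟨a, ha, rfl⟩, b, hb, rfl⟩ | ⟨⟨a, ha, rfl⟩, b, hb, rfl⟩)
    · exact ⟨a * b, mul_ne_zero ha hb, Pmap_smul_smul a b u v⟩
    · exact ⟨a * b, mul_ne_zero ha hb, by rw [Pmap_smul_smul, Pmap_comm]⟩
end
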